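/- arXiv:2208.04922 — 3 statements merged into one kernel-verified Lean document; each statement's English description precedes it below -/
import Mathlib

section
/- For every x ∈ (0,1), ξ(x) < 1 − μ, and ξ(1) = 1 − μ. In particular, if the certification cost satisfies γ ≥ 1 − μ, then ξ(x) ≤ γ for all x ∈ (0,1]. -/
open MeasureTheory Set intervalIntegral

/-- Integration by parts against the primitive of a function continuous on `[0,1]`. -/
lemma integral_id_mul_eq_sub_integral_primitive {f F : ℝ → ℝ}
    (hf : ContinuousOn f (Icc 0 1)) (hF : ∀ x, F x = ∫ t in (0:ℝ)..x, f t)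
    (hFc : ContinuousOn F (Icc 0 1)) {x : ℝ} (hx0 : 0 ≤ x) (hx1 : x ≤ 1) :
    (∫ t in (0:ℝ)..x, t * f t) = x * F x - ∫ t in (0:ℝ)..x, F t := by
  have hsub : Icc 0 x ⊆ Icc (0:ℝ) 1 := Icc_subset_Icc_right hx1
  have hint : ∀ y ∈ Icc (0:ℝ) x, IntervalIntegrable f volume 0 y := fun y hy =>
    (hf.mono (Icc_subset_Icc_right (hy.2.trans hx1))).intervalIntegrable_of_Icc hy.1
  have key := integral_mul_deriv_eq_deriv_mul_of_hasDerivAt (a := 0) (b := x)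
    (u := fun t => t) (v := F) (u' := fun _ => 1) (v' := f)
    continuousOn_id (by rw [uIcc_of_le hx0]; exact hFc.mono hsub)
    (fun t _ => hasDerivAt_id t)
    (fun t ht => by
      rw [min_eq_left hx0, max_eq_right hx0] at ht
      have hnhds : Ioo (0:ℝ) 1 ∈ nhds t := Ioo_mem_nhds ht.1 (ht.2.trans_le hx1)
      rw [funext hF]
      exact integral_hasDerivAt_right (hint t (Ioo_subset_Icc_self ht))
        ((hf.mono Ioo_subset_Icc_self).stronglyMeasurableAtFilter isOpen_Ioo t
          (mem_of_mem_nhds hnhds))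
        (hf.continuousAt (Filter.mem_of_superset hnhds Ioo_subset_Icc_self)))
    intervalIntegrable_const (hint x ⟨hx0, le_rfl⟩)
  simpa using key

/-- A concave function on `(0,1]` has larger increments over `[s,x]` than over the translate
of that interval ending at `1`. -/
lemma ConcaveOn.add_le_add_translate {L : ℝ → ℝ} (hL : ConcaveOn ℝ (Ioc 0 1) L)
    {s x : ℝ} (hs : 0 < s) (hsx : s < x) (hx : x < 1) :
    L s + L 1 ≤ L x + L (s + (1 - x)) := by
  have h1s : 0 < 1 - s := by linarith
  have hs' : s ∈ Ioc (0:ℝ) 1 := ⟨hs, by linarith⟩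
  have ha : 0 ≤ (1 - x) / (1 - s) := div_nonneg (by linarith) h1s.le
  have hb : 0 ≤ (x - s) / (1 - s) := div_nonneg (by linarith) h1s.le
  have hab : (1 - x) / (1 - s) + (x - s) / (1 - s) = 1 := by field_simp; ring
  have h1 := hL.2 hs' (right_mem_Ioc.2 one_pos) ha hb hab
  have h2 := hL.2 hs' (right_mem_Ioc.2 one_pos) hb ha (by rw [add_comm, hab])
  simp only [smul_eq_mul] at h1 h2
  rw [show (1 - x) / (1 - s) * s + (x - s) / (1 - s) * 1 = x by field_simp; ring] at h1
  rw [show (x - s) / (1 - s) * s + (1 - x) / (1 - s) * 1 = s + (1 - x) by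
    field_simp; ring] at h2
  linear_combination h1 + h2 - (L s + L 1) * hab

/-- `ξ x < 1 - μ` for every `x ∈ (0,1)`, and `ξ 1 = 1 - μ`.
In particular, if the certification cost satisfies `γ ≥ 1 - μ`, then `ξ x ≤ γ`
for all `x ∈ (0,1]`. -/
theorem xi_lt_one_sub_mean
    (f : ℝ → ℝ)
    (hf_cont : ContinuousOn f (Icc 0 1))
    (hf_pos : ∀ t ∈ Icc (0:ℝ) 1, 0 < f t)
    (hf_int : (∫ t in (0:ℝ)..1, f t) = 1)
    (F : ℝ → ℝ) (hF : ∀ x, F x = ∫ t in (0:ℝ)..x, f t)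
    (μ : ℝ) (hμdef : μ = ∫ t in (0:ℝ)..1, t * f t) (hμ : μ ∈ Ioo (0:ℝ) 1)
    (hlog : StrictConcaveOn ℝ (Ioc (0:ℝ) 1) (fun x => Real.log (F x)))
    (ξ : ℝ → ℝ) (hξ : ∀ x, ξ x = x - (∫ t in (0:ℝ)..x, t * f t) / F x) :
    (∀ x ∈ Ioo (0:ℝ) 1, ξ x < 1 - μ) ∧ ξ 1 = 1 - μ ∧
      (∀ γ : ℝ, 1 - μ ≤ γ → ∀ x ∈ Ioc (0:ℝ) 1, ξ x ≤ γ) := by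
  have hF1 : F 1 = 1 := by rw [hF, hf_int]
  have hFc : ContinuousOn F (Icc 0 1) := by
    rw [funext hF, ← uIcc_of_le zero_le_one]
    exact continuousOn_primitive_interval
      (by rw [uIcc_of_le zero_le_one]; exact hf_cont.integrableOn_Icc)
  have hFpos : ∀ x ∈ Ioc (0:ℝ) 1, 0 < F x := fun x hx => by
    have hsub : Icc 0 x ⊆ Icc (0:ℝ) 1 := Icc_subset_Icc_right hx.2
    rw [hF]
    exact intervalIntegral_pos_of_pos_on
      ((hf_cont.mono hsub).intervalIntegrable_of_Icc hx.1.le)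
      (fun t ht => hf_pos t (hsub (Ioo_subset_Icc_self ht))) hx.1
  have hFint : ∀ a b : ℝ, 0 ≤ a → a ≤ b → b ≤ 1 → IntervalIntegrable F volume a b :=
    fun a b ha hab hb => (hFc.mono (Icc_subset_Icc ha hb)).intervalIntegrable_of_Icc hab
  have hone : ξ 1 = 1 - μ := by rw [hξ, hF1, hμdef, div_one]
  have hmean : 1 - μ = ∫ t in (0:ℝ)..1, F t := by
    rw [hμdef, integral_id_mul_eq_sub_integral_primitive hf_cont hF hFc zero_le_one le_rfl, hF1]
    ring
  have hlt : ∀ x ∈ Ioo (0:ℝ) 1, ξ x < 1 - μ := by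
    intro x hx
    have hx' : x ∈ Ioc (0:ℝ) 1 := Ioo_subset_Ioc_self hx
    have hd : 0 < 1 - x := sub_pos.2 hx.2
    have hFx := hFpos x hx'
    have hshift : ∀ s ∈ Ioo 0 x, F s ≤ F x * F (s + (1 - x)) := by
      intro s hs
      have hFs := hFpos s ⟨hs.1, (hs.2.trans hx.2).le⟩
      have hFsd := hFpos (s + (1 - x)) ⟨by linarith [hs.1], by linarith [hs.2]⟩
      have h := hlog.concaveOn.add_le_add_translate hs.1 hs.2 hx.2
      rw [hF1, Real.log_one, add_zero, ← Real.log_mul hFx.ne' hFsd.ne'] at h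
      exact (Real.log_le_log_iff hFs (mul_pos hFx hFsd)).1 h
    have hcomp : IntervalIntegrable (fun s => F (s + (1 - x))) volume 0 x := by
      refine ContinuousOn.intervalIntegrable_of_Icc hx.1.le (hFc.comp (by fun_prop) ?_)
      intro s hs
      exact ⟨by linarith [hs.1], by linarith [hs.2]⟩
    have hle : (∫ s in (0:ℝ)..x, F s) ≤ F x * ∫ s in (1 - x)..1, F s := by
      calc (∫ s in (0:ℝ)..x, F s) ≤ ∫ s in (0:ℝ)..x, F x * F (s + (1 - x)) :=
            integral_mono_on_of_le_Ioo hx.1.le (hFint 0 x le_rfl hx.1.le hx'.2)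
              (hcomp.const_mul _) hshift
        _ = F x * ∫ s in (1 - x)..1, F s := by
            rw [intervalIntegral.integral_const_mul, integral_comp_add_right]
            simp
    have hsplit : (∫ s in (1 - x)..1, F s) < ∫ s in (0:ℝ)..1, F s := by
      rw [← integral_add_adjacent_intervals (hFint 0 (1 - x) le_rfl hd.le (by linarith [hx.1]))
        (hFint (1 - x) 1 hd.le (by linarith [hx.1]) le_rfl)]
      exact lt_add_of_pos_left _ (intervalIntegral_pos_of_pos_on
        (hFint 0 (1 - x) le_rfl hd.le (by linarith [hx.1]))
        (fun t ht => hFpos t ⟨ht.1, by linarith [ht.2, hx.1]⟩) hd)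
    have hξx : ξ x = (∫ s in (0:ℝ)..x, F s) / F x := by
      rw [hξ, integral_id_mul_eq_sub_integral_primitive hf_cont hF hFc hx.1.le hx'.2]
      field_simp
      ring
    rw [hξx, hmean, div_lt_iff₀' hFx]
    exact hle.trans_lt (mul_lt_mul_of_pos_left hsplit hFx)
  refine ⟨hlt, hone, fun γ hγ x hx => ?_⟩
  rcases hx.2.lt_or_eq with h | rfl
  · exact (hlt x ⟨hx.1, h⟩).le.trans hγ
  · exact hone.le.trans hγ
end

section
/- Fix γ > 0 and κ > 0. For every α ∈ [0,μ], there is exactly one Q ∈ M(F) that maximizes ∫₀¹ V_α(x) dQ(x) over M(F) (i.e., a maximizer exists and it is unique). -/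
open MeasureTheory Set intervalIntegral

/-- The cumulative distribution function of a Borel measure on `ℝ`. -/
noncomputable def mcdf (Q : Measure ℝ) (s : ℝ) : ℝ := (Q (Iic s)).toReal

/-- `Q` is a mean-preserving contraction of `Q'`. -/
def IsMPC (Q Q' : Measure ℝ) : Prop :=
  (∀ x ∈ Icc (0:ℝ) 1, (∫ s in (0:ℝ)..x, mcdf Q s) ≤ ∫ s in (0:ℝ)..x, mcdf Q' s) ∧
    (∫ s in (0:ℝ)..1, mcdf Q s) = ∫ s in (0:ℝ)..1, mcdf Q' s

/-- `Q ∈ 𝓜(F)`: `Q` is a probability measure on `[0,1]` that is a mean-preserving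
contraction of the prior `P`. -/
def MemM (P Q : Measure ℝ) : Prop :=
  IsProbabilityMeasure Q ∧ Q (Icc (0:ℝ) 1)ᶜ = 0 ∧ IsMPC Q P

/-- The topological support of a measure on `ℝ`: points all of whose neighborhoods have
positive measure. -/
def msupport (Q : Measure ℝ) : Set ℝ := {x | ∀ U ∈ nhds x, Q U ≠ 0}


lemma integrable_of_continuous_of_supported (Q : Measure ℝ) [IsFiniteMeasure Q]
    (hQ : Q (Icc (0:ℝ) 1)ᶜ = 0) {φ : ℝ → ℝ} (hφ : Continuous φ) : Integrable φ Q := by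
  have h : Q.restrict (Icc (0:ℝ) 1) = Q :=
    Measure.restrict_eq_self_of_ae_mem (by rw [ae_iff]; exact hQ)
  rw [← h]
  exact hφ.continuousOn.integrableOn_compact isCompact_Icc

lemma integral_mcdf_eq (Q : Measure ℝ) [IsProbabilityMeasure Q]
    (hQ : Q (Icc (0:ℝ) 1)ᶜ = 0) {x : ℝ} (hx : x ∈ Icc (0:ℝ) 1) :
    ∫ s in (0:ℝ)..x, mcdf Q s = ∫ y, max (x - y) 0 ∂Q := by
  have h1 : ∀ s, mcdf Q s = ∫ y, {p : ℝ × ℝ | p.2 ≤ p.1}.indicator (fun _ => (1:ℝ)) (s, y) ∂Q := by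
    intro s
    have : (fun y => {p : ℝ × ℝ | p.2 ≤ p.1}.indicator (fun _ => (1:ℝ)) (s, y))
        = (Iic s).indicator 1 := by
      ext y; simp [indicator]
    rw [this, integral_indicator_one measurableSet_Iic]
    rfl
  rw [intervalIntegral.integral_of_le hx.1, ← integral_Icc_eq_integral_Ioc]
  simp_rw [h1]
  rw [integral_integral_swap]
  · apply MeasureTheory.integral_congr_ae
    have : ∀ᵐ y ∂Q, y ∈ Icc (0:ℝ) 1 := by rw [ae_iff]; exact hQ
    filter_upwards [this] with y hy
    have : (fun s => {p : ℝ × ℝ | p.2 ≤ p.1}.indicator (fun _ => (1:ℝ)) (s, y))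
        = (Ici y).indicator 1 := by
      ext s; simp [indicator]
    rw [this, integral_indicator_one measurableSet_Ici,
      measureReal_restrict_apply measurableSet_Ici,
      show Ici y ∩ Icc 0 x = Icc y x by
        ext s
        simp only [mem_inter_iff, mem_Ici, mem_Icc]
        exact ⟨fun h => ⟨h.1, h.2.2⟩, fun h => ⟨h.1, hy.1.trans h.1, h.2⟩⟩]
    rw [Measure.real, Real.volume_Icc, ENNReal.toReal_ofReal']
  · exact (integrable_const (1:ℝ)).indicator (measurableSet_le measurable_snd measurable_fst)

lemma memM_iff (P Q : Measure ℝ) [IsProbabilityMeasure P] (hP : P (Icc (0:ℝ) 1)ᶜ = 0) :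
    MemM P Q ↔ IsProbabilityMeasure Q ∧ Q (Icc (0:ℝ) 1)ᶜ = 0 ∧
      (∀ x ∈ Icc (0:ℝ) 1, ∫ y, max (x - y) 0 ∂Q ≤ ∫ y, max (x - y) 0 ∂P) ∧
      ∫ y, y ∂Q = ∫ y, y ∂P := by
  have key : ∀ ν : Measure ℝ, IsProbabilityMeasure ν → ν (Icc (0:ℝ) 1)ᶜ = 0 →
      ∫ y, max (1 - y) 0 ∂ν = 1 - ∫ y, y ∂ν := by
    intro ν _ hν
    have : ∀ᵐ y ∂ν, y ∈ Icc (0:ℝ) 1 := by rw [ae_iff]; exact hν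
    rw [MeasureTheory.integral_congr_ae (g := fun y => 1 - y) (by
      filter_upwards [this] with y hy
      exact max_eq_left (by linarith [hy.2])),
      MeasureTheory.integral_sub (integrable_const _)
        (integrable_of_continuous_of_supported ν hν (φ := fun y => y) continuous_id)]
    simp
  unfold MemM IsMPC
  refine and_congr_right fun h1 => and_congr_right fun h2 => and_congr ?_ ?_
  · refine forall₂_congr fun x hx => ?_
    rw [integral_mcdf_eq Q h2 hx, integral_mcdf_eq P hP hx]
  · rw [integral_mcdf_eq Q h2 (by simp), integral_mcdf_eq P hP (by simp), key Q h1 h2,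
      key P inferInstance hP]
    constructor <;> intro h <;> linarith

/-- Jensen's inequality on a piece of a measure, with a barycenter that works for all convex
functions simultaneously, including when the piece is null. -/
lemma exists_barycenter (Q : Measure ℝ) [IsFiniteMeasure Q] {u v : ℝ} (huv : u ≤ v) (s : Set ℝ)
    (hs : ∀ᵐ x ∂Q.restrict s, x ∈ Icc u v) :
    ∃ l ∈ Icc u v, ∀ φ : ℝ → ℝ, Continuous φ →
      (ConvexOn ℝ (Icc u v) φ → Q.real s * φ l ≤ ∫ x in s, φ x ∂Q) ∧
      (StrictConvexOn ℝ (Icc u v) φ → Q.real s * φ l = ∫ x in s, φ x ∂Q →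
        ∀ᵐ x ∂Q.restrict s, x = l) := by
  have hint : ∀ φ : ℝ → ℝ, Continuous φ → IntegrableOn φ s Q := by
    intro φ hφ
    have h : (Q.restrict s).restrict (Icc u v) = Q.restrict s :=
      Measure.restrict_eq_self_of_ae_mem hs
    rw [IntegrableOn, ← h]
    exact hφ.continuousOn.integrableOn_compact isCompact_Icc
  by_cases h0 : Q s = 0
  · refine ⟨u, left_mem_Icc.2 huv, fun φ _ => ?_⟩
    have h0' : Q.restrict s = 0 := Measure.restrict_eq_zero.2 h0
    simp [h0', Measure.real, h0]
  · have hpos : 0 < Q.real s := ENNReal.toReal_pos h0 (measure_ne_top _ _)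
    have havg : ∀ φ : ℝ → ℝ, Q.real s * (⨍ x in s, φ x ∂Q) = ∫ x in s, φ x ∂Q := by
      intro φ
      rw [setAverage_eq, smul_eq_mul, mul_inv_cancel_left₀ hpos.ne']
    refine ⟨⨍ x in s, x ∂Q, (convex_Icc u v).set_average_mem isClosed_Icc h0 (measure_ne_top _ _)
      hs (hint _ continuous_id), fun φ hφ => ⟨fun hc => ?_, fun hc heq => ?_⟩⟩
    · rw [← havg]
      exact mul_le_mul_of_nonneg_left (hc.map_set_average_le hφ.continuousOn isClosed_Icc h0
        (measure_ne_top _ _) hs (hint _ continuous_id) (hint _ hφ)) hpos.le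
    · rw [← havg] at heq
      rcases hc.ae_eq_const_or_map_average_lt hφ.continuousOn isClosed_Icc hs
        (hint _ continuous_id) (hint _ hφ) with h | h
      · exact h
      · exact absurd (mul_left_cancel₀ hpos.ne' heq) h.ne

lemma restrict_eq_smul_dirac (Q : Measure ℝ) (s : Set ℝ) (l : ℝ)
    (h : ∀ᵐ x ∂Q.restrict s, x = l) : Q.restrict s = Q s • Measure.dirac l := by
  calc Q.restrict s = (Q.restrict s).map id := Measure.map_id.symm
    _ = (Q.restrict s).map (fun _ => l) := Measure.map_congr h
    _ = Q s • Measure.dirac l := by rw [Measure.map_const, Measure.restrict_apply_univ]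

/-- The measure with mass `p` at `l` and mass `1 - p` at `h`. -/
noncomputable def binaryMeasure (p l h : ℝ) : Measure ℝ :=
  ENNReal.ofReal p • Measure.dirac l + ENNReal.ofReal (1 - p) • Measure.dirac h

lemma isProbabilityMeasure_binaryMeasure {p : ℝ} (hp : p ∈ Icc (0:ℝ) 1) (l h : ℝ) :
    IsProbabilityMeasure (binaryMeasure p l h) := by
  constructor
  simp only [binaryMeasure, Measure.add_apply, Measure.smul_apply, measure_univ, smul_eq_mul,
    mul_one]
  rw [← ENNReal.ofReal_add hp.1 (by linarith [hp.2])]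
  simp

lemma integral_binaryMeasure {p : ℝ} (hp : p ∈ Icc (0:ℝ) 1) (l h : ℝ) (φ : ℝ → ℝ) :
    ∫ x, φ x ∂binaryMeasure p l h = p * φ l + (1 - p) * φ h := by
  rw [binaryMeasure, integral_add_measure
    ((integrable_dirac (by simp)).smul_measure ENNReal.ofReal_ne_top)
    ((integrable_dirac (by simp)).smul_measure ENNReal.ofReal_ne_top)]
  simp [MeasureTheory.integral_smul_measure, ENNReal.toReal_ofReal hp.1,
    ENNReal.toReal_ofReal (sub_nonneg.2 hp.2)]

lemma binaryMeasure_compl_Icc (p : ℝ) {l h : ℝ} (hl : l ∈ Icc (0:ℝ) 1) (hh : h ∈ Icc (0:ℝ) 1) :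
    binaryMeasure p l h (Icc (0:ℝ) 1)ᶜ = 0 := by
  have hm : MeasurableSet (Icc (0:ℝ) 1)ᶜ := measurableSet_Icc.compl
  simp only [binaryMeasure, Measure.add_apply, Measure.smul_apply, Measure.dirac_apply' _ hm,
    smul_eq_mul]
  simp [hl.1, hl.2, hh.1, hh.2]

lemma eq_binaryMeasure (Q : Measure ℝ) [IsProbabilityMeasure Q] {s : Set ℝ} (hs : MeasurableSet s)
    {l h : ℝ} (h1 : ∀ᵐ x ∂Q.restrict s, x = l) (h2 : ∀ᵐ x ∂Q.restrict sᶜ, x = h) :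
    Q = binaryMeasure (Q.real s) l h := by
  conv_lhs => rw [← Measure.restrict_add_restrict_compl (μ := Q) hs,
    restrict_eq_smul_dirac Q s l h1, restrict_eq_smul_dirac Q sᶜ h h2]
  rw [binaryMeasure, ← probReal_compl_eq_one_sub hs, ofReal_measureReal, ofReal_measureReal]

lemma binaryMeasure_eq_of_integral_eq {p q l h : ℝ} (hp : p ∈ Icc (0:ℝ) 1) (hq : q ∈ Icc (0:ℝ) 1)
    (heq : ∫ x, x ∂binaryMeasure p l h = ∫ x, x ∂binaryMeasure q l h) :
    binaryMeasure p l h = binaryMeasure q l h := by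
  rw [integral_binaryMeasure hp, integral_binaryMeasure hq] at heq
  have hz : (p - q) * (l - h) = 0 := by linarith
  rcases mul_eq_zero.1 hz with hz | hz
  · rw [sub_eq_zero.1 hz]
  · have hdirac : ∀ r ∈ Icc (0:ℝ) 1, binaryMeasure r h h = Measure.dirac h := by
      intro r hr
      rw [binaryMeasure, ← add_smul, ← ENNReal.ofReal_add hr.1 (by linarith [hr.2])]
      simp
    rw [sub_eq_zero.1 hz, hdirac p hp, hdirac q hq]

/-- Collapsing the parts of `Q` below and above `a` to their barycenters gives a binary
mean-preserving contraction, which strictly lowers the integral of a function that is strictly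
convex on both sides of `a` unless `Q` was already binary. -/
lemma MemM.exists_binaryMeasure {P Q : Measure ℝ} [IsProbabilityMeasure P]
    (hP : P (Icc (0:ℝ) 1)ᶜ = 0) (hQ : MemM P Q) {a : ℝ} (ha : a ∈ Icc (0:ℝ) 1) {U : ℝ → ℝ}
    (hU : Continuous U) (hUl : StrictConvexOn ℝ (Icc 0 a) U) (hUr : StrictConvexOn ℝ (Icc a 1) U) :
    ∃ p ∈ Icc (0:ℝ) 1, ∃ l ∈ Icc (0:ℝ) 1, ∃ h ∈ Icc (0:ℝ) 1, MemM P (binaryMeasure p l h) ∧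
      ∫ x, U x ∂binaryMeasure p l h ≤ ∫ x, U x ∂Q ∧
      (∫ x, U x ∂binaryMeasure p l h = ∫ x, U x ∂Q →
        (∀ᵐ x ∂Q.restrict (Iio a), x = l) ∧ ∀ᵐ x ∂Q.restrict (Iio a)ᶜ, x = h) := by
  obtain ⟨hprob, hsupp, hmpc, hmean⟩ := (memM_iff P Q hP).1 hQ
  have hae : ∀ᵐ x ∂Q, x ∈ Icc (0:ℝ) 1 := by rw [ae_iff]; exact hsupp
  obtain ⟨l, hl, hlφ⟩ := exists_barycenter Q ha.1 (Iio a) (by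
    filter_upwards [ae_restrict_of_ae hae, ae_restrict_mem measurableSet_Iio] with x hx hxa
    exact ⟨hx.1, (mem_Iio.1 hxa).le⟩)
  obtain ⟨h, hh, hhφ⟩ := exists_barycenter Q ha.2 (Iio a)ᶜ (by
    filter_upwards [ae_restrict_of_ae hae, ae_restrict_mem measurableSet_Iio.compl] with x hx hxa
    exact ⟨not_lt.1 hxa, hx.2⟩)
  have hp : Q.real (Iio a) ∈ Icc (0:ℝ) 1 := ⟨measureReal_nonneg, measureReal_le_one⟩
  have hl' : l ∈ Icc (0:ℝ) 1 := ⟨hl.1, hl.2.trans ha.2⟩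
  have hh' : h ∈ Icc (0:ℝ) 1 := ⟨ha.1.trans hh.1, hh.2⟩
  have hsplit : ∀ φ : ℝ → ℝ, Continuous φ →
      ∫ x, φ x ∂Q = ∫ x in Iio a, φ x ∂Q + ∫ x in (Iio a)ᶜ, φ x ∂Q := fun φ hφ =>
    (integral_add_compl measurableSet_Iio
      (integrable_of_continuous_of_supported Q hsupp hφ)).symm
  have hbin : ∀ φ : ℝ → ℝ, ∫ x, φ x ∂binaryMeasure (Q.real (Iio a)) l h =
      Q.real (Iio a) * φ l + Q.real (Iio a)ᶜ * φ h := fun φ => by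
    rw [integral_binaryMeasure hp, probReal_compl_eq_one_sub measurableSet_Iio]
  have hle : ∀ φ : ℝ → ℝ, Continuous φ → ConvexOn ℝ (Icc 0 a) φ → ConvexOn ℝ (Icc a 1) φ →
      ∫ x, φ x ∂binaryMeasure (Q.real (Iio a)) l h ≤ ∫ x, φ x ∂Q := by
    intro φ hφ h1 h2
    rw [hbin, hsplit φ hφ]
    exact add_le_add ((hlφ φ hφ).1 h1) ((hhφ φ hφ).1 h2)
  refine ⟨_, hp, l, hl', h, hh', (memM_iff P _ hP).2
    ⟨isProbabilityMeasure_binaryMeasure hp l h, binaryMeasure_compl_Icc _ hl' hh', ?_, ?_⟩,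
    hle U hU hUl.convexOn hUr.convexOn, ?_⟩
  · intro x hx
    have hconv : ConvexOn ℝ univ fun y : ℝ => max (x - y) 0 :=
      ((convexOn_const x convex_univ).sub (concaveOn_id convex_univ)).sup
        (convexOn_const 0 convex_univ)
    exact (hle _ (by fun_prop) (hconv.subset (subset_univ _) (convex_Icc _ _))
      (hconv.subset (subset_univ _) (convex_Icc _ _))).trans (hmpc x hx)
  · rw [← hmean]
    refine le_antisymm (hle _ continuous_id (convexOn_id (convex_Icc _ _))
      (convexOn_id (convex_Icc _ _))) ?_
    have := hle (fun y => -y) continuous_neg (concaveOn_id (convex_Icc _ _)).neg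
      (concaveOn_id (convex_Icc _ _)).neg
    rw [MeasureTheory.integral_neg, MeasureTheory.integral_neg] at this
    exact neg_le_neg_iff.1 this
  · intro heq
    rw [hbin, hsplit U hU] at heq
    have h1 := (hlφ U hU).1 hUl.convexOn
    have h2 := (hhφ U hU).1 hUr.convexOn
    exact ⟨(hlφ U hU).2 hUl (by linarith), (hhφ U hU).2 hUr (by linarith)⟩

lemma isCompact_setOf_memM_binaryMeasure (P : Measure ℝ) [IsProbabilityMeasure P]
    (hP : P (Icc (0:ℝ) 1)ᶜ = 0) :
    IsCompact {t : ℝ × ℝ × ℝ | t ∈ Icc (0:ℝ) 1 ×ˢ Icc (0:ℝ) 1 ×ˢ Icc (0:ℝ) 1 ∧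
      MemM P (binaryMeasure t.1 t.2.1 t.2.2)} := by
  have heq : {t : ℝ × ℝ × ℝ | t ∈ Icc (0:ℝ) 1 ×ˢ Icc (0:ℝ) 1 ×ˢ Icc (0:ℝ) 1 ∧
      MemM P (binaryMeasure t.1 t.2.1 t.2.2)} =
      (Icc (0:ℝ) 1 ×ˢ Icc (0:ℝ) 1 ×ˢ Icc (0:ℝ) 1) ∩
      ({t : ℝ × ℝ × ℝ | ∀ x ∈ Icc (0:ℝ) 1,
        t.1 * max (x - t.2.1) 0 + (1 - t.1) * max (x - t.2.2) 0 ≤ ∫ y, max (x - y) 0 ∂P} ∩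
      {t | t.1 * t.2.1 + (1 - t.1) * t.2.2 = ∫ y, y ∂P}) := by
    ext ⟨p, l, h⟩
    refine and_congr_right fun ht => ?_
    obtain ⟨hp, hl, hh⟩ := ht
    simp only at hp hl hh
    simp only [memM_iff P _ hP, isProbabilityMeasure_binaryMeasure hp,
      binaryMeasure_compl_Icc p hl hh, integral_binaryMeasure hp, true_and, mem_inter_iff,
      mem_ofPred_eq]
  rw [heq]
  refine (isCompact_Icc.prod (isCompact_Icc.prod isCompact_Icc)).inter_right
    (IsClosed.inter ?_ (isClosed_eq (by fun_prop) continuous_const))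
  simp only [ofPred_forall]
  exact isClosed_iInter fun x => isClosed_iInter fun _ =>
    isClosed_le (by fun_prop) continuous_const

lemma integral_midpoint (Q₁ Q₂ : Measure ℝ) {φ : ℝ → ℝ} (h₁ : Integrable φ Q₁)
    (h₂ : Integrable φ Q₂) :
    ∫ x, φ x ∂((2⁻¹ : ENNReal) • Q₁ + (2⁻¹ : ENNReal) • Q₂) =
      (∫ x, φ x ∂Q₁ + ∫ x, φ x ∂Q₂) / 2 := by
  rw [integral_add_measure (h₁.smul_measure (by simp)) (h₂.smul_measure (by simp)),
    MeasureTheory.integral_smul_measure, MeasureTheory.integral_smul_measure]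
  simp only [ENNReal.toReal_inv, ENNReal.toReal_ofNat, smul_eq_mul]
  ring

lemma MemM.midpoint {P Q₁ Q₂ : Measure ℝ} [IsProbabilityMeasure P]
    (hP : P (Icc (0:ℝ) 1)ᶜ = 0) (h₁ : MemM P Q₁) (h₂ : MemM P Q₂) :
    MemM P ((2⁻¹ : ENNReal) • Q₁ + (2⁻¹ : ENNReal) • Q₂) := by
  obtain ⟨_, hs₁, hi₁, hm₁⟩ := (memM_iff P _ hP).1 h₁
  obtain ⟨_, hs₂, hi₂, hm₂⟩ := (memM_iff P _ hP).1 h₂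
  have hint₁ : ∀ φ : ℝ → ℝ, Continuous φ → Integrable φ Q₁ := fun φ =>
    integrable_of_continuous_of_supported Q₁ hs₁
  have hint₂ : ∀ φ : ℝ → ℝ, Continuous φ → Integrable φ Q₂ := fun φ =>
    integrable_of_continuous_of_supported Q₂ hs₂
  refine (memM_iff P _ hP).2 ⟨⟨?_⟩, ?_, fun x hx => ?_, ?_⟩
  · simp [ENNReal.inv_two_add_inv_two]
  · simp [hs₁, hs₂]
  · rw [integral_midpoint _ _ (hint₁ _ (by fun_prop)) (hint₂ _ (by fun_prop))]
    linarith [hi₁ x hx, hi₂ x hx]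
  · rw [integral_midpoint _ _ (hint₁ (fun y => y) continuous_id)
      (hint₂ (fun y => y) continuous_id), hm₁, hm₂]
    ring

lemma memM_self (P : Measure ℝ) [IsProbabilityMeasure P] (hP : P (Icc (0:ℝ) 1)ᶜ = 0) :
    MemM P P :=
  ⟨inferInstance, hP, fun _ _ => le_rfl, rfl⟩

/-- A continuous function that is strictly convex on both sides of a point has exactly one
minimizer among the mean-preserving contractions of `P`. -/
theorem existsUnique_minimizer (P : Measure ℝ) [IsProbabilityMeasure P]
    (hP : P (Icc (0:ℝ) 1)ᶜ = 0) {a : ℝ} (ha : a ∈ Icc (0:ℝ) 1) {U : ℝ → ℝ}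
    (hU : Continuous U) (hUl : StrictConvexOn ℝ (Icc 0 a) U) (hUr : StrictConvexOn ℝ (Icc a 1) U) :
    ∃! Q : Measure ℝ, MemM P Q ∧
      ∀ Q' : Measure ℝ, MemM P Q' → ∫ x, U x ∂Q ≤ ∫ x, U x ∂Q' := by
  refine existsUnique_of_exists_of_unique ?_ ?_
  · obtain ⟨p, hp, l, hl, h, hh, hmem, -⟩ := (memM_self P hP).exists_binaryMeasure hP ha hU hUl hUr
    obtain ⟨⟨q, m, n⟩, ⟨⟨hq, -⟩, hqM⟩, hmin⟩ :=
      (isCompact_setOf_memM_binaryMeasure P hP).exists_isMinOn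
        ⟨(p, l, h), ⟨hp, hl, hh⟩, hmem⟩
        (f := fun t : ℝ × ℝ × ℝ => t.1 * U t.2.1 + (1 - t.1) * U t.2.2)
        (by fun_prop)
    refine ⟨binaryMeasure q m n, hqM, fun Q' hQ' => ?_⟩
    obtain ⟨p', hp', l', hl', h', hh', hmem', hle, -⟩ := hQ'.exists_binaryMeasure hP ha hU hUl hUr
    refine le_trans ?_ hle
    rw [integral_binaryMeasure hq, integral_binaryMeasure hp']
    exact isMinOn_iff.1 hmin (p', l', h') ⟨⟨hp', hl', hh'⟩, hmem'⟩
  · rintro Q₁ Q₂ ⟨h₁, hmin₁⟩ ⟨h₂, hmin₂⟩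
    have hmid := h₁.midpoint hP h₂
    obtain ⟨_, hs₁, -, hm₁⟩ := (memM_iff P _ hP).1 h₁
    obtain ⟨_, hs₂, -, hm₂⟩ := (memM_iff P _ hP).1 h₂
    have hval := integral_midpoint Q₁ Q₂ (integrable_of_continuous_of_supported Q₁ hs₁ hU)
      (integrable_of_continuous_of_supported Q₂ hs₂ hU)
    obtain ⟨p, hp, l, hl, h, hh, hmem, hle, heq⟩ := hmid.exists_binaryMeasure hP ha hU hUl hUr
    obtain ⟨hlo, hhi⟩ := heq (by linarith [hmin₁ _ hmem, hmin₂ _ hmem])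
    have htwo : (2⁻¹ : ENNReal) ≠ 0 := by simp
    rw [Measure.restrict_add, Measure.restrict_smul, Measure.restrict_smul,
      ae_add_measure_iff, Measure.ae_ennreal_smul_measure_iff htwo,
      Measure.ae_ennreal_smul_measure_iff htwo] at hlo hhi
    have e₁ := eq_binaryMeasure Q₁ measurableSet_Iio hlo.1 hhi.1
    have e₂ := eq_binaryMeasure Q₂ measurableSet_Iio hlo.2 hhi.2
    rw [e₁, e₂]
    refine binaryMeasure_eq_of_integral_eq ⟨measureReal_nonneg, measureReal_le_one⟩
      ⟨measureReal_nonneg, measureReal_le_one⟩ ?_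
    rw [← e₁, ← e₂, hm₁, hm₂]

/-- For fixed `γ > 0`, `κ > 0`, and every `α ∈ [0,μ]`, the problem of
maximizing `∫ V_α dQ` over `𝓜(F)`, where `V_α x = max α (x - γ) - κ c x`, has exactly
one solution. -/
theorem optimal_acquisition_exists_unique
    (f : ℝ → ℝ) (P : Measure ℝ)
    (hf_cont : ContinuousOn f (Icc 0 1))
    (hf_pos : ∀ t ∈ Icc (0:ℝ) 1, 0 < f t)
    (hP : P = (volume.restrict (Icc (0:ℝ) 1)).withDensity fun t => ENNReal.ofReal (f t))
    (hPprob : IsProbabilityMeasure P)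
    (μ : ℝ) (hμdef : μ = ∫ t in (0:ℝ)..1, t * f t) (hμ : μ ∈ Ioo (0:ℝ) 1)
    (hlog : StrictConcaveOn ℝ (Ioc (0:ℝ) 1) fun x => Real.log (∫ t in (0:ℝ)..x, f t))
    (c : ℝ → ℝ) (hc : ContDiff ℝ 2 c) (hcconv : StrictConvexOn ℝ (Icc 0 1) c)
    (hcμ : c μ = 0)
    (κ γ : ℝ) (hκ : 0 < κ) (hγ : 0 < γ) :
    ∀ α ∈ Icc (0:ℝ) μ,
      ∃! Q : Measure ℝ, MemM P Q ∧
        ∀ Q' : Measure ℝ, MemM P Q' →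
          (∫ x, (max α (x - γ) - κ * c x) ∂Q') ≤ ∫ x, (max α (x - γ) - κ * c x) ∂Q := by
  intro α hα
  have hPsupp : P (Icc (0:ℝ) 1)ᶜ = 0 := by
    rw [hP]
    refine withDensity_absolutelyContinuous _ _ ?_
    rw [Measure.restrict_apply measurableSet_Icc.compl]
    simp
  have hcκ : StrictConvexOn ℝ (Icc (0:ℝ) 1) fun x => κ * c x := by
    refine ⟨hcconv.1, fun x hx y hy hxy s t hs ht hst => ?_⟩
    have := mul_lt_mul_of_pos_left (hcconv.2 hx hy hxy hs ht hst) hκ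
    simp only [smul_eq_mul] at this ⊢
    linarith
  have hpos : 0 ≤ α + γ := add_nonneg hα.1 hγ.le
  have ha : min (α + γ) 1 ∈ Icc (0:ℝ) 1 := ⟨le_min hpos zero_le_one, min_le_right _ _⟩
  have hUl : StrictConvexOn ℝ (Icc 0 (min (α + γ) 1)) fun x => -(max α (x - γ) - κ * c x) := by
    refine ((hcκ.subset (Icc_subset_Icc le_rfl ha.2) (convex_Icc _ _)).add_const (-α)).congr ?_
    intro x hx
    have : x - γ ≤ α := by linarith [hx.2.trans (min_le_left _ _)]
    simp only [Pi.add_apply, max_eq_left this]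
    ring
  have hUr : StrictConvexOn ℝ (Icc (min (α + γ) 1) 1) fun x => -(max α (x - γ) - κ * c x) := by
    rcases le_total (α + γ) 1 with h | h
    · rw [min_eq_left h]
      refine ((hcκ.subset (Icc_subset_Icc hpos le_rfl) (convex_Icc _ _)).add_convexOn
        ((convexOn_const γ (convex_Icc _ _)).sub (concaveOn_id (convex_Icc _ _)))).congr ?_
      intro x hx
      have : α ≤ x - γ := by linarith [hx.1]
      simp only [Pi.add_apply, Pi.sub_apply, max_eq_right this, id]
      ring
    · rw [min_eq_right h, Icc_self]
      refine ⟨convex_singleton _, fun x hx y hy hxy => absurd ?_ hxy⟩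
      rw [mem_singleton_iff.1 hx, mem_singleton_iff.1 hy]
  have hcont : Continuous fun x => -(max α (x - γ) - κ * c x) := by
    have := hc.continuous
    fun_prop
  have := existsUnique_minimizer P hPsupp ha hcont hUl hUr
  simpa only [MeasureTheory.integral_neg, neg_le_neg_iff] using this
end

section
/- There exists ε₀ > 0 such that for every ε ∈ (0, ε₀], the symmetric two-point measure (1/2)δ_{μ−ε} + (1/2)δ_{μ+ε} is a mean-preserving contraction of P. -/
open MeasureTheory Set intervalIntegral

/-- The integrated cumulative distribution function is the expected shortfall. -/
theorem integral_mcdf (Q : Measure ℝ) [IsFiniteMeasure Q] (h0 : ∀ᵐ t ∂Q, 0 ≤ t) {x : ℝ}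
    (hx : 0 ≤ x) : (∫ s in (0:ℝ)..x, mcdf Q s) = ∫ t, max (x - t) 0 ∂Q := by
  have hmeas : MeasurableSet {p : ℝ × ℝ | p.2 ≤ p.1} :=
    measurableSet_le measurable_snd measurable_fst
  have hcdf : ∀ s, mcdf Q s = ∫ t, {p : ℝ × ℝ | p.2 ≤ p.1}.indicator (fun _ => (1:ℝ)) (s, t) ∂Q := by
    intro s
    rw [show (fun t => {p : ℝ × ℝ | p.2 ≤ p.1}.indicator (fun _ => (1:ℝ)) (s, t))
      = (Iic s).indicator 1 from rfl, integral_indicator_one measurableSet_Iic]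
    rfl
  have hint : Integrable (Function.uncurry fun s t : ℝ =>
      {p : ℝ × ℝ | p.2 ≤ p.1}.indicator (fun _ => (1:ℝ)) (s, t))
      ((volume.restrict (Ioc 0 x)).prod Q) :=
    (integrable_const (1:ℝ)).indicator hmeas
  simp_rw [hcdf]
  rw [integral_of_le hx, integral_integral_swap hint]
  refine integral_congr_ae (h0.mono fun t ht => ?_)
  change ∫ s in Ioc 0 x, (Ici t).indicator 1 s = max (x - t) 0
  rw [integral_indicator_one measurableSet_Ici, measureReal_restrict_apply measurableSet_Ici,
    measureReal_congr (Ioi_ae_eq_Ici.symm.inter (ae_eq_refl (Ioc 0 x))), inter_comm,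
    Ioc_inter_Ioi, max_eq_right ht, Real.volume_real_Ioc]

/-- If `P` on `[0,1]` has mean `μ` and expected shortfall at least `ε` at some `y ≤ μ - ε`, then
the symmetric two-point measure on `μ ± ε` is a mean-preserving contraction of `P`. -/
theorem memM_two_point (P : Measure ℝ) [IsProbabilityMeasure P] (hsupp : ∀ᵐ t ∂P, t ∈ Icc (0:ℝ) 1)
    {μ y : ℝ} (hmean : ∫ t, t ∂P = μ) {ε : ℝ} (hε : 0 < ε)
    (hε₀ : ε ≤ μ) (hε₁ : ε ≤ 1 - μ) (hy : y ≤ μ - ε) (hεy : ε ≤ ∫ t, max (y - t) 0 ∂P) :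
    MemM P ((1/2 : ENNReal) • Measure.dirac (μ - ε) +
      (1/2 : ENNReal) • Measure.dirac (μ + ε)) := by
  set Q : Measure ℝ := (1/2 : ENNReal) • Measure.dirac (μ - ε) +
    (1/2 : ENNReal) • Measure.dirac (μ + ε) with hQ
  have hQprob : IsProbabilityMeasure Q :=
    ⟨by simp [hQ, ENNReal.inv_two_add_inv_two]⟩
  have hQsupp : Q (Icc (0:ℝ) 1)ᶜ = 0 := by
    have h1 : μ - ε ∈ Icc (0:ℝ) 1 := ⟨by linarith, by linarith⟩
    have h2 : μ + ε ∈ Icc (0:ℝ) 1 := ⟨by linarith, by linarith⟩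
    simp [hQ, Measure.dirac_apply' _ measurableSet_Icc.compl, -mem_Icc, h1, h2]
  have hQint : ∀ x : ℝ, ∫ t, max (x - t) 0 ∂Q =
      (max (x - (μ - ε)) 0 + max (x - (μ + ε)) 0) / 2 := by
    intro x
    have hi : ∀ a : ℝ, Integrable (fun t => max (x - t) 0)
        ((1/2 : ENNReal) • Measure.dirac a) := fun a =>
      (integrable_dirac enorm_lt_top).smul_measure (by simp)
    rw [hQ, integral_add_measure (hi _) (hi _)]
    simp only [MeasureTheory.integral_smul_measure, integral_dirac]
    simp
    ring
  have hid : Integrable (fun t : ℝ => t) P :=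
    Integrable.of_mem_Icc 0 1 aemeasurable_id hsupp
  have hsub : ∀ x : ℝ, Integrable (fun t => x - t) P := fun x => (integrable_const x).sub hid
  have hmax : ∀ x : ℝ, Integrable (fun t => max (x - t) 0) P := fun x =>
    (hsub x).sup (integrable_zero _ _ _)
  have hsubint : ∀ x : ℝ, ∫ t, (x - t) ∂P = x - μ := fun x => by
    rw [integral_sub (integrable_const x) hid, hmean]; simp
  have hQ0 : ∀ᵐ t ∂Q, 0 ≤ t :=
    (show ∀ᵐ t ∂Q, t ∈ Icc (0:ℝ) 1 from hQsupp).mono fun t ht => ht.1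
  have hP0 : ∀ᵐ t ∂P, 0 ≤ t := hsupp.mono fun t ht => ht.1
  refine ⟨hQprob, hQsupp, fun x hx => ?_, ?_⟩
  · rw [integral_mcdf Q hQ0 hx.1, integral_mcdf P hP0 hx.1, hQint]
    have hnonneg : 0 ≤ ∫ t, max (x - t) 0 ∂P := integral_nonneg fun t => le_max_right _ _
    have hjensen : x - μ ≤ ∫ t, max (x - t) 0 ∂P := by
      rw [← hsubint x]
      exact integral_mono (hsub x) (hmax x) fun t => le_max_left _ _
    rcases le_total x (μ - ε) with h | h
    · rw [max_eq_right (by linarith), max_eq_right (by linarith)]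
      linarith
    rcases le_total x (μ + ε) with h' | h'
    · have hmono : ∫ t, max (y - t) 0 ∂P ≤ ∫ t, max (x - t) 0 ∂P :=
        integral_mono (hmax y) (hmax x) fun t => max_le_max_right 0 (by linarith)
      rw [max_eq_left (by linarith), max_eq_right (by linarith)]
      linarith
    · rw [max_eq_left (by linarith), max_eq_left (by linarith)]
      linarith
  · rw [integral_mcdf Q hQ0 zero_le_one, integral_mcdf P hP0 zero_le_one, hQint,
      max_eq_left (by linarith), max_eq_left (by linarith)]
    have : ∫ t, max (1 - t) 0 ∂P = ∫ t, (1 - t) ∂P :=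
      integral_congr_ae (hsupp.mono fun t ht => max_eq_left (by linarith [ht.2]))
    rw [this, hsubint]
    ring

/-- There exists `ε₀ > 0` such that for every `ε ∈ (0, ε₀]`, the
symmetric two-point measure `(1/2) δ_{μ-ε} + (1/2) δ_{μ+ε}` is a mean-preserving
contraction of the prior `P`, i.e. lies in `𝓜(F)`. -/
theorem symmetric_two_point_mpc
    (f : ℝ → ℝ) (P : Measure ℝ)
    (hf_cont : ContinuousOn f (Icc 0 1))
    (hf_pos : ∀ t ∈ Icc (0:ℝ) 1, 0 < f t)
    (hP : P = (volume.restrict (Icc (0:ℝ) 1)).withDensity fun t => ENNReal.ofReal (f t))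
    (hPprob : IsProbabilityMeasure P)
    (μ : ℝ) (hμdef : μ = ∫ t in (0:ℝ)..1, t * f t) (hμ : μ ∈ Ioo (0:ℝ) 1) :
    ∃ ε₀ : ℝ, 0 < ε₀ ∧ ∀ ε ∈ Ioc (0:ℝ) ε₀,
      MemM P ((1/2 : ENNReal) • Measure.dirac (μ - ε) +
        (1/2 : ENNReal) • Measure.dirac (μ + ε)) := by
  have hsupp : ∀ᵐ t ∂P, t ∈ Icc (0:ℝ) 1 := by
    rw [hP]
    exact (withDensity_absolutelyContinuous _ _).ae_le (ae_restrict_mem measurableSet_Icc)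
  have hf_meas : AEMeasurable f (volume.restrict (Icc (0:ℝ) 1)) :=
    hf_cont.aemeasurable measurableSet_Icc
  have hint : ∀ g : ℝ → ℝ, ∫ t, g t ∂P = ∫ t in (0:ℝ)..1, g t * f t := by
    intro g
    rw [hP, integral_withDensity_eq_integral_toReal_smul₀ hf_meas.ennreal_ofReal (by simp),
      integral_of_le zero_le_one, ← integral_Icc_eq_integral_Ioc]
    refine setIntegral_congr_fun measurableSet_Icc fun t ht => ?_
    simp [ENNReal.toReal_ofReal (hf_pos t ht).le, mul_comm]
  have hmean : ∫ t, t ∂P = μ := by rw [hint, hμdef]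
  have hpos : 0 < ∫ t, max (μ / 2 - t) 0 ∂P := by
    rw [hint]
    refine integral_pos zero_lt_one (ContinuousOn.mul (by fun_prop) hf_cont)
      (fun t ht => mul_nonneg (le_max_right _ _) (hf_pos t ⟨ht.1.le, ht.2⟩).le)
      ⟨0, by simp, mul_pos (lt_max_of_lt_left ?_) (hf_pos 0 (by simp))⟩
    linarith [hμ.1]
  refine ⟨min (∫ t, max (μ / 2 - t) 0 ∂P) (min (μ / 2) (1 - μ)),
    lt_min hpos (lt_min (by linarith [hμ.1]) (by linarith [hμ.2])), fun ε hε => ?_⟩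
  obtain ⟨hε₁, hε₂, hε₃⟩ : _ ∧ _ ∧ _ := by simpa only [le_min_iff] using hε.2
  exact memM_two_point P hsupp hmean hε.1 (by linarith [hμ.1]) hε₃
    (by linarith : μ / 2 ≤ μ - ε) hε₁
end
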